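/- Fix a real Hilbert space V, an integer s ≥ 1 and real coefficients α_0, …, α_s with α_0 = α_1 = 1. Assume the energy identity: there are an integer k* with 1 ≤ k* ≤ s, reals β_{k*}, …, β_s, and symmetric reals (γ_{i,j})_{0≤i,j≤s−1} such that for every semi-negative continuous linear operator Z on V and every u0 ∈ V, ‖R(Z)u0‖² − ‖u0‖² = Σ_{k=k*}^s β_k ‖Z^k u0‖² + Σ_{i,j=0}^{s−1} γ_{i,j} [Z^i u0, Z^j u0]. Let μ, ν ∈ ℝ with ν > −β_{k*}/2, and assume either μ = 0, or k* ≥ 2 together with α_2 = 1/2. Then the modified method is not strongly stable: there exists λ₀ > 0 such that for every continuous linear operator Z on V satisfying ⟨Zv, v⟩ = 0 for all v ∈ V and ‖Z‖ ≤ λ₀, and every u0 ∈ V with Z^{k*} u0 ≠ 0, one has ‖u_M‖ > ‖u0‖, where Z̃ := Z + μ(Z†)^{k*−1}Z^{k*} + ν(Z†)^{k*}Z^{k*} and u_M := R(Z̃) u0. -/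

import Mathlib

open RealInnerProductSpace ContinuousLinearMap

/-- The semi-inner-product `[v, w] := −⟨Zv, w⟩ − ⟨v, Zw⟩` associated with `Z`. -/
noncomputable def semiIP {V : Type*} [NormedAddCommGroup V] [InnerProductSpace ℝ V]
    (Z : V →L[ℝ] V) (v w : V) : ℝ :=
  -⟪Z v, w⟫ - ⟪v, Z w⟫

open Polynomial in
/-- If `X ^ (d + 1)` divides `T - X`, then `X ^ (d + j)` divides `T ^ j - X ^ j`. -/
theorem X_pow_dvd_pow_sub_X_pow {A : Type*} [CommRing A] {T : A[X]} {d : ℕ}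
    (h : X ^ (d + 1) ∣ T - X) (j : ℕ) : X ^ (d + j) ∣ T ^ j - X ^ j := by
  have hX : X ∣ T := by
    have h1 : X ∣ T - X := (Dvd.intro_left (X ^ d) (pow_succ X d).symm).trans h
    simpa using dvd_add h1 (dvd_refl X)
  induction j with
  | zero => simp
  | succ j ih =>
    have e : T ^ (j + 1) - X ^ (j + 1) = T ^ j * (T - X) + X * (T ^ j - X ^ j) := by ring
    rw [e]
    refine dvd_add ?_ ?_
    · rw [show (X : A[X]) ^ (d + (j + 1)) = X ^ j * X ^ (d + 1) by ring]
      exact mul_dvd_mul (pow_dvd_pow_of_dvd hX j) h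
    · rw [show (X : A[X]) ^ (d + (j + 1)) = X * X ^ (d + j) by ring]
      exact mul_dvd_mul_left X ih

open Polynomial in
/-- The stability polynomial `∑ j ≤ s, α j X ^ j` of an explicit Runge-Kutta method. -/
noncomputable def stabilityPoly (s : ℕ) (α : ℕ → ℝ) : ℝ[X] :=
  ∑ j ∈ Finset.range (s + 1), C (α j) * X ^ j

open Polynomial in
/-- The polynomial `X + a X ^ (2m+1) + b X ^ (2m+2)` which maps a skew-adjoint operator to its
modification. -/
noncomputable def modifier (m : ℕ) (a b : ℝ) : ℝ[X] :=
  X + C a * X ^ (2 * m + 1) + C b * X ^ (2 * m + 2)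

open Polynomial in
theorem stabilityPoly_comp_modifier_sub {s m : ℕ} {α : ℕ → ℝ} {a b : ℝ} (hα1 : α 1 = 1)
    (hms : m + 1 ≤ s) (hcase : a = 0 ∨ (1 ≤ m ∧ α 2 = 1 / 2)) :
    X ^ (2 * m + 3) ∣ (stabilityPoly s α).comp (modifier m a b) - stabilityPoly s α
      - (C a * X ^ (2 * m + 1) + C (a + b) * X ^ (2 * m + 2)) := by
  have hsub : (stabilityPoly s α).comp (modifier m a b) - stabilityPoly s α
      = ∑ j ∈ Finset.range (s + 1), C (α j) * (modifier m a b ^ j - X ^ j) := by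
    simp [stabilityPoly, Polynomial.sum_comp, mul_sub, Finset.sum_sub_distrib]
  rw [hsub]
  rcases hcase with rfl | ⟨hm, hα2⟩
  · have hd : (X : ℝ[X]) ^ ((2 * m + 1) + 1) ∣ modifier m 0 b - X :=
      ⟨C b, by simp only [modifier, C_0]; ring⟩
    obtain ⟨r, rfl⟩ : ∃ r, s = r + 1 := ⟨s - 1, by omega⟩
    rw [Finset.sum_range_succ', Finset.sum_range_succ']
    have h : X ^ (2 * m + 3) ∣ ∑ j ∈ Finset.range r,
        C (α (j + 1 + 1)) * (modifier m 0 b ^ (j + 1 + 1) - X ^ (j + 1 + 1)) :=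
      Finset.dvd_sum fun j _ => Dvd.dvd.mul_left
        ((pow_dvd_pow X (by omega)).trans (X_pow_dvd_pow_sub_X_pow hd (j + 1 + 1))) _
    convert h using 1
    simp [modifier, hα1]
  · obtain ⟨n, rfl⟩ : ∃ n, m = n + 1 := ⟨m - 1, by omega⟩
    have hd : (X : ℝ[X]) ^ ((2 * n + 2) + 1) ∣ modifier (n + 1) a b - X :=
      ⟨C a + C b * X, by simp only [modifier]; ring⟩
    obtain ⟨r, rfl⟩ : ∃ r, s = r + 2 := ⟨s - 2, by omega⟩
    rw [Finset.sum_range_succ', Finset.sum_range_succ', Finset.sum_range_succ']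
    have h : X ^ (2 * (n + 1) + 3) ∣ ∑ j ∈ Finset.range r,
        C (α (j + 1 + 1 + 1)) *
          (modifier (n + 1) a b ^ (j + 1 + 1 + 1) - X ^ (j + 1 + 1 + 1)) :=
      Finset.dvd_sum fun j _ => Dvd.dvd.mul_left
        ((pow_dvd_pow X (by omega)).trans (X_pow_dvd_pow_sub_X_pow hd (j + 1 + 1 + 1))) _
    obtain ⟨E, hE⟩ := h
    have hC : (2 : ℝ[X]) * C (1 / 2) = 1 := by
      rw [show (2 : ℝ[X]) = C 2 from rfl, ← C_mul]; norm_num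
    rw [hE]
    refine ⟨E + C (1 / 2) * (2 * C b
      + X ^ (2 * n + 1) * (C a + C b * X) ^ 2), ?_⟩
    simp only [modifier, hα1, hα2, zero_add, Nat.reduceAdd, C_1, pow_zero, sub_self, mul_zero,
      C_add]
    linear_combination (C a * X ^ (2 * n + 4)) * hC

open Polynomial in
theorem X_sq_dvd_stabilityPoly_sub {s : ℕ} {α : ℕ → ℝ} (hs : 1 ≤ s)
    (hα0 : α 0 = 1) (hα1 : α 1 = 1) :
    X ^ 2 ∣ stabilityPoly s α - (1 + X) := by
  obtain ⟨r, rfl⟩ : ∃ r, s = r + 1 := ⟨s - 1, by omega⟩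
  rw [stabilityPoly, Finset.sum_range_succ', Finset.sum_range_succ']
  have h : (X : ℝ[X]) ^ 2 ∣ ∑ j ∈ Finset.range r, C (α (j + 1 + 1)) * X ^ (j + 1 + 1) :=
    Finset.dvd_sum fun j _ => Dvd.dvd.mul_left (pow_dvd_pow X (by omega)) _
  convert h using 1
  simp [hα0, hα1]
  ring

open Polynomial in
/-- Modification changes `R(X) R(-X)` only by `2 b X ^ (2m+2)`, up to higher order terms. -/
theorem stabilityPoly_comp_modifier_mul_comp_neg {s m : ℕ} {α : ℕ → ℝ} {a b : ℝ}
    (hα0 : α 0 = 1) (hα1 : α 1 = 1) (hms : m + 1 ≤ s)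
    (hcase : a = 0 ∨ (1 ≤ m ∧ α 2 = 1 / 2)) :
    X ^ (2 * m + 3) ∣ ((stabilityPoly s α).comp (modifier m a b)
        * ((stabilityPoly s α).comp (modifier m a b)).comp (-X))
      - stabilityPoly s α * (stabilityPoly s α).comp (-X) - C (2 * b) * X ^ (2 * m + 2) := by
  obtain ⟨E, hE⟩ := stabilityPoly_comp_modifier_sub (b := b) hα1 hms hcase
  obtain ⟨S, hS⟩ := X_sq_dvd_stabilityPoly_sub (by omega : 1 ≤ s) hα0 hα1
  have hE' := congrArg (fun p : ℝ[X] => p.comp (-X)) hE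
  have hS' := congrArg (fun p : ℝ[X] => p.comp (-X)) hS
  have o1 : (-X : ℝ[X]) ^ (2 * m + 1) = -X ^ (2 * m + 1) := Odd.neg_pow ⟨m, rfl⟩ X
  have o2 : (-X : ℝ[X]) ^ (2 * m + 2) = X ^ (2 * m + 2) := Even.neg_pow ⟨m + 1, by ring⟩ X
  have o3 : (-X : ℝ[X]) ^ (2 * m + 3) = -X ^ (2 * m + 3) :=
    Odd.neg_pow ⟨m + 1, by ring⟩ X
  simp only [Polynomial.sub_comp, Polynomial.add_comp, mul_comp, C_comp, X_comp, pow_comp,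
    one_comp, o1, o2, o3, even_two.neg_pow] at hE' hS'
  set P := (stabilityPoly s α).comp (modifier m a b)
  set Q := P.comp (-X)
  set R := stabilityPoly s α
  set R' := R.comp (-X)
  set E' := E.comp (-X)
  set S' := S.comp (-X)
  have hP : P = R + (C a * X ^ (2 * m + 1) + C (a + b) * X ^ (2 * m + 2))
      + X ^ (2 * m + 3) * E := by linear_combination hE
  have hQ : Q = R' + (-(C a * X ^ (2 * m + 1)) + C (a + b) * X ^ (2 * m + 2))
      - X ^ (2 * m + 3) * E' := by linear_combination hE'
  have hR : R = 1 + X + X ^ 2 * S := by linear_combination hS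
  have hR' : R' = 1 - X + X ^ 2 * S' := by linear_combination hS'
  have hG : X ^ (2 * m + 3) ∣ C a ^ 2 * X ^ (4 * m + 2) := by
    rcases hcase with rfl | ⟨hm, -⟩
    · simp
    · exact Dvd.dvd.mul_left (pow_dvd_pow X (by omega)) _
  obtain ⟨K, hK⟩ := hG
  refine ⟨-E' * P + E * (R' + (-(C a * X ^ (2 * m + 1)) + C (a + b) * X ^ (2 * m + 2)))
    + S * (-C a + C (a + b) * X) + S' * (C a + C (a + b) * X)
    + C (a + b) ^ 2 * X ^ (2 * m + 1) - K, ?_⟩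
  rw [hQ, hP, hR, hR']
  simp only [C_add, C_mul, map_ofNat]
  linear_combination -hK

section Skew

variable {V : Type*} [NormedAddCommGroup V] [InnerProductSpace ℝ V]

open Polynomial in
theorem aeval_stabilityPoly (s : ℕ) (α : ℕ → ℝ) (Z : V →L[ℝ] V) :
    aeval Z (stabilityPoly s α) = ∑ j ∈ Finset.range (s + 1), α j • Z ^ j := by
  simp [stabilityPoly, Algebra.smul_def]

theorem inner_apply_eq_neg_inner_apply {Z : V →L[ℝ] V} (hZ : ∀ v, ⟪Z v, v⟫ = 0) (v w : V) :
    ⟪Z v, w⟫ = -⟪v, Z w⟫ := by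
  have h := hZ (v + w)
  simp only [map_add, inner_add_left, inner_add_right, hZ] at h
  rw [real_inner_comm (Z w) v]
  linarith

theorem adjoint_eq_neg_of_inner_self_eq_zero [CompleteSpace V] {Z : V →L[ℝ] V}
    (hZ : ∀ v, ⟪Z v, v⟫ = 0) : adjoint Z = -Z := by
  symm
  rw [ContinuousLinearMap.eq_adjoint_iff]
  intro v w
  simp [inner_apply_eq_neg_inner_apply hZ v w]

theorem inner_pow_apply {Z : V →L[ℝ] V} (hZ : ∀ v, ⟪Z v, v⟫ = 0) (n : ℕ) (v w : V) :
    ⟪(Z ^ n) v, w⟫ = (-1) ^ n * ⟪v, (Z ^ n) w⟫ := by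
  induction n generalizing v w with
  | zero => simp
  | succ n ih =>
    rw [pow_succ', mul_apply_eq_comp, inner_apply_eq_neg_inner_apply hZ, ih,
      ← mul_apply_eq_comp, ← pow_succ, ← pow_succ']
    ring

theorem inner_pow_two_mul_apply_self {Z : V →L[ℝ] V} (hZ : ∀ v, ⟪Z v, v⟫ = 0) (n : ℕ) (v : V) :
    ⟪(Z ^ (2 * n)) v, v⟫ = (-1) ^ n * ‖(Z ^ n) v‖ ^ 2 := by
  rw [two_mul, pow_add, mul_apply_eq_comp, inner_pow_apply hZ,
    real_inner_self_eq_norm_sq]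

open Polynomial in
theorem inner_aeval_apply {Z : V →L[ℝ] V} (hZ : ∀ v, ⟪Z v, v⟫ = 0) (p : ℝ[X]) (v w : V) :
    ⟪(aeval Z p) v, w⟫ = ⟪v, (aeval Z (p.comp (-X))) w⟫ := by
  induction p using Polynomial.induction_on' with
  | add p q hp hq => simp [inner_add_left, inner_add_right, hp, hq]
  | monomial n r =>
    have e : (monomial n r).comp (-X : ℝ[X]) = C ((-1) ^ n * r) * X ^ n := by
      rw [monomial_comp, neg_pow, C_mul, C_pow, C_neg, C_1]; ring
    rw [e, aeval_monomial, map_mul, aeval_C, aeval_X_pow]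
    simp only [← Algebra.smul_def, smul_apply, inner_smul_left,
      inner_smul_right, inner_pow_apply hZ]
    simp
    ring

open Polynomial in
theorem norm_aeval_apply_sq {Z : V →L[ℝ] V} (hZ : ∀ v, ⟪Z v, v⟫ = 0) (p : ℝ[X]) (v : V) :
    ‖(aeval Z p) v‖ ^ 2 = ⟪(aeval Z (p * p.comp (-X))) v, v⟫ := by
  rw [← real_inner_self_eq_norm_sq, inner_aeval_apply hZ, ← mul_apply_eq_comp,
    ← map_mul, mul_comm, real_inner_comm]

open Polynomial in
theorem norm_aeval_le {Z : V →L[ℝ] V} (hZ : ‖Z‖ ≤ 1) (p : ℝ[X]) :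
    ‖aeval Z p‖ ≤ p.sum fun _ r => |r| := by
  rw [aeval_eq_sum_range, Polynomial.sum_over_range _ (fun _ => abs_zero)]
  refine norm_sum_le_of_le _ fun n _ => ?_
  rw [norm_smul, Real.norm_eq_abs]
  refine mul_le_of_le_one_right (abs_nonneg _) ?_
  rcases n with _ | n
  · exact ContinuousLinearMap.norm_id_le
  · exact (norm_pow_le' Z n.succ_pos).trans (pow_le_one₀ (norm_nonneg Z) hZ)

open Polynomial in
/-- Comparing powers of `t` in the energy identity for the operators `t • Z`, with `Z`
skew-adjoint, determines the low order coefficients of `R(X) R(-X)`. -/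
theorem coeff_mul_inner_pow {s k : ℕ} {β : ℕ → ℝ} {p : ℝ[X]} {Z : V →L[ℝ] V} {u : V}
    (hZ : ∀ v, ⟪Z v, v⟫ = 0)
    (h : ∀ t : ℝ, ‖(aeval (t • Z) p) u‖ ^ 2 - ‖u‖ ^ 2
      = ∑ j ∈ Finset.Icc k s, β j * ‖((t • Z) ^ j) u‖ ^ 2) (n : ℕ) :
    (p * p.comp (-X)).coeff n * ⟪(Z ^ n) u, u⟫ = (if n = 0 then ‖u‖ ^ 2 else 0)
      + ∑ j ∈ Finset.Icc k s, if n = 2 * j then β j * ‖(Z ^ j) u‖ ^ 2 else 0 := by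
  set W := p * p.comp (-X) with hW
  have hpoly : (∑ i ∈ Finset.range (W.natDegree + 1), C (W.coeff i * ⟪(Z ^ i) u, u⟫) * X ^ i)
      = C (‖u‖ ^ 2) + ∑ j ∈ Finset.Icc k s, C (β j * ‖(Z ^ j) u‖ ^ 2) * X ^ (2 * j) := by
    refine Polynomial.funext fun t => ?_
    have ht : ∀ v, ⟪(t • Z) v, v⟫ = 0 := fun v => by simp [inner_smul_left, hZ]
    have h1 := h t
    rw [norm_aeval_apply_sq ht, ← hW, aeval_eq_sum_range] at h1
    simp only [sum_apply, sum_inner, _root_.smul_pow, smul_apply,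
      inner_smul_left, norm_smul, eval_finsetSum, eval_add, eval_mul, eval_C, eval_pow, eval_X,
      conj_trivial] at h1 ⊢
    rw [sub_eq_iff_eq_add'] at h1
    convert h1 using 2
    · ring
    · refine Finset.sum_congr rfl fun j _ => ?_
      rw [mul_pow, Real.norm_eq_abs, sq_abs]
      ring
  have hc := congrArg (fun q : ℝ[X] => q.coeff n) hpoly
  simp only [finsetSum_coeff, coeff_C_mul_X_pow, coeff_add, coeff_C, Finset.sum_ite_eq,
    Finset.mem_range] at hc
  rw [← hc]
  split_ifs with hn
  · rfl
  · rw [coeff_eq_zero_of_natDegree_lt (by omega), zero_mul]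

open Polynomial in
theorem X_pow_dvd_mul_comp_neg_sub {s k : ℕ} {β : ℕ → ℝ} {p : ℝ[X]} {Z : V →L[ℝ] V} {u : V}
    (hk : 1 ≤ k) (hks : k ≤ s) (hZ : ∀ v, ⟪Z v, v⟫ = 0) (hu : (Z ^ k) u ≠ 0)
    (h : ∀ t : ℝ, ‖(aeval (t • Z) p) u‖ ^ 2 - ‖u‖ ^ 2
      = ∑ j ∈ Finset.Icc k s, β j * ‖((t • Z) ^ j) u‖ ^ 2) :
    X ^ (2 * k + 1) ∣ p * p.comp (-X) - 1 - C ((-1) ^ k * β k) * X ^ (2 * k) := by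
  rw [X_pow_dvd_iff]
  intro n hn
  have hcoeff := coeff_mul_inner_pow hZ h n
  have heven : (p * p.comp (-X)).comp (-X) = p * p.comp (-X) := by
    rw [mul_comp, Polynomial.comp_assoc]
    simp [mul_comm]
  simp only [coeff_sub, coeff_C_mul_X_pow, coeff_one]
  generalize p * p.comp (-X) = W at hcoeff heven ⊢
  rcases Nat.even_or_odd' n with ⟨m, rfl | rfl⟩
  · have hm : ‖(Z ^ m) u‖ ^ 2 ≠ 0 := by
      refine pow_ne_zero 2 (norm_ne_zero_iff.2 fun h0 => hu ?_)
      rw [show k = (k - m) + m by omega, pow_add, mul_apply_eq_comp, h0, map_zero]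
    rw [inner_pow_two_mul_apply_self hZ] at hcoeff
    have hsq : ((-1 : ℝ) ^ m) * (-1) ^ m = 1 := by rw [← mul_pow]; simp
    have hsum : (∑ j ∈ Finset.Icc k s, if 2 * m = 2 * j then β j * ‖(Z ^ j) u‖ ^ 2 else 0)
        = if m = k then β k * ‖(Z ^ k) u‖ ^ 2 else 0 := by
      rw [Finset.sum_eq_single k]
      · simp
      · intro j hj hjk
        rw [Finset.mem_Icc] at hj
        rw [if_neg (by omega)]
      · simp [hks]
    rw [hsum] at hcoeff
    refine mul_right_cancel₀ hm ?_
    rcases eq_or_ne m 0 with rfl | hm0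
    · have : ¬ (0 = k) := by omega
      rw [if_pos (by omega), if_neg this] at hcoeff
      rw [if_pos (by omega), if_neg (by omega)]
      simp only [pow_zero, one_apply_eq_self] at hcoeff ⊢
      linarith
    · rcases eq_or_ne m k with rfl | hmk
      · rw [if_neg (by omega), if_pos rfl] at hcoeff
        rw [if_neg (by omega), if_pos rfl]
        linear_combination (-1) ^ m * hcoeff
          - W.coeff (2 * m) * ‖(Z ^ m) u‖ ^ 2 * hsq
      · rw [if_neg (by omega), if_neg hmk] at hcoeff
        rw [if_neg (by omega), if_neg (by omega)]
        linear_combination (-1) ^ m * hcoeff - W.coeff (2 * m) * ‖(Z ^ m) u‖ ^ 2 * hsq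
  · have hodd := congrArg (fun q : ℝ[X] => q.coeff (2 * m + 1)) heven
    rw [show (-X : ℝ[X]) = C (-1) * X by simp] at hodd
    simp only [comp_C_mul_X_coeff] at hodd
    rw [Odd.neg_one_pow ⟨m, rfl⟩] at hodd
    rw [if_neg (by omega), if_neg (by omega)]
    linarith

open Polynomial in
theorem inner_aeval_X_pow_mul {Z : V →L[ℝ] V} (hZ : ∀ v, ⟪Z v, v⟫ = 0) (k : ℕ) (p : ℝ[X])
    (u : V) :
    ⟪(aeval Z (X ^ (2 * k) * p)) u, u⟫ = (-1) ^ k * ⟪(aeval Z p) ((Z ^ k) u), (Z ^ k) u⟫ := by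
  rw [show (X : ℝ[X]) ^ (2 * k) * p = X ^ k * (p * X ^ k) by ring, map_mul, map_mul, aeval_X_pow,
    mul_apply_eq_comp, inner_pow_apply hZ, mul_apply_eq_comp]

end Skew

/-- the modified method is NOT strongly stable when `ν > −β_{k*}/2`:
for energy conservative `Z` with small norm, the modified-method solution has strictly
larger norm whenever `Z^{k*} u0 ≠ 0`. -/
theorem modified_not_strongly_stable
    {V : Type*} [NormedAddCommGroup V] [InnerProductSpace ℝ V] [CompleteSpace V]
    (s : ℕ) (hs : 1 ≤ s) (α : ℕ → ℝ) (hα0 : α 0 = 1) (hα1 : α 1 = 1)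
    (kst : ℕ) (hk1 : 1 ≤ kst) (hks : kst ≤ s)
    (β : ℕ → ℝ) (γ : ℕ → ℕ → ℝ) (hsym : ∀ i j, γ i j = γ j i)
    (hidentity : ∀ Z : V →L[ℝ] V, (∀ v : V, ⟪Z v, v⟫ ≤ 0) → ∀ u0 : V,
      ‖(∑ j ∈ Finset.range (s + 1), α j • Z ^ j) u0‖ ^ 2 - ‖u0‖ ^ 2
        = ∑ k ∈ Finset.Icc kst s, β k * ‖(Z ^ k) u0‖ ^ 2
          + ∑ i ∈ Finset.range s, ∑ j ∈ Finset.range s,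
              γ i j * semiIP Z ((Z ^ i) u0) ((Z ^ j) u0))
    (μ ν : ℝ) (hν : -β kst / 2 < ν)
    (hcase : μ = 0 ∨ (2 ≤ kst ∧ α 2 = 1 / 2)) :
    ∃ lam0 : ℝ, 0 < lam0 ∧
      ∀ Z : V →L[ℝ] V, (∀ v : V, ⟪Z v, v⟫ = 0) → ‖Z‖ ≤ lam0 → ∀ u0 : V,
        (Z ^ kst) u0 ≠ 0 →
        ‖(∑ j ∈ Finset.range (s + 1),
            α j • (Z + μ • (adjoint Z ^ (kst - 1) * Z ^ kst)
              + ν • (adjoint Z ^ kst * Z ^ kst)) ^ j) u0‖ > ‖u0‖ := by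
  by_cases hex : ∃ (Z : V →L[ℝ] V) (u : V), (∀ v : V, ⟪Z v, v⟫ = 0) ∧ (Z ^ kst) u ≠ 0
  swap
  · exact ⟨1, one_pos, fun Z hZ _ u hu => absurd ⟨Z, u, hZ, hu⟩ hex⟩
  obtain ⟨Z₀, w, hZ₀, hw⟩ := hex
  have hskew : ∀ t : ℝ, ‖(Polynomial.aeval (t • Z₀) (stabilityPoly s α)) w‖ ^ 2 - ‖w‖ ^ 2
      = ∑ j ∈ Finset.Icc kst s, β j * ‖((t • Z₀) ^ j) w‖ ^ 2 := by
    intro t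
    have ht : ∀ v, ⟪(t • Z₀) v, v⟫ = 0 := fun v => by simp [inner_smul_left, hZ₀]
    rw [aeval_stabilityPoly, hidentity (t • Z₀) (fun v => (ht v).le) w, add_eq_left]
    refine Finset.sum_eq_zero fun i _ => Finset.sum_eq_zero fun j _ => ?_
    rw [semiIP, inner_apply_eq_neg_inner_apply ht, neg_neg, sub_self, mul_zero]
  obtain ⟨F₁, hF₁⟩ := X_pow_dvd_mul_comp_neg_sub hk1 hks hZ₀ hw hskew
  obtain ⟨m, rfl⟩ : ∃ m, kst = m + 1 := ⟨kst - 1, by omega⟩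
  obtain ⟨F₂, hF₂⟩ := stabilityPoly_comp_modifier_mul_comp_neg (m := m) (a := (-1) ^ m * μ)
    (b := (-1) ^ (m + 1) * ν) hα0 hα1 hks
    (hcase.imp (fun h => by rw [h, mul_zero]) fun h => ⟨by omega, h.2⟩)
  set P := (stabilityPoly s α).comp (modifier m ((-1) ^ m * μ) ((-1) ^ (m + 1) * ν)) with hP
  have hPP : P * P.comp (-Polynomial.X) = 1 + Polynomial.X ^ (2 * (m + 1)) *
      (Polynomial.C ((-1) ^ (m + 1) * (β (m + 1) + 2 * ν)) + Polynomial.X * (F₁ + F₂)) := by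
    simp only [Polynomial.C_mul, Polynomial.C_add] at hF₁ hF₂ ⊢
    linear_combination hF₁ + hF₂
  set δ := β (m + 1) + 2 * ν
  have hδ0 : 0 < δ := by linarith
  set M := (F₁ + F₂).sum fun _ r => |r|
  have hM0 : 0 ≤ M := Finset.sum_nonneg fun _ _ => abs_nonneg _
  refine ⟨min 1 (δ / (M + 1)), by positivity, fun Z hZ hZn u hu => ?_⟩
  have hop : Z + μ • (adjoint Z ^ (m + 1 - 1) * Z ^ (m + 1))
        + ν • (adjoint Z ^ (m + 1) * Z ^ (m + 1))
      = Polynomial.aeval Z (modifier m ((-1) ^ m * μ) ((-1) ^ (m + 1) * ν)) := by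
    have hneg : ∀ n : ℕ, (-Z) ^ n = ((-1 : ℝ) ^ n) • Z ^ n := fun n => by
      rw [← _root_.smul_pow, neg_one_smul]
    simp only [modifier, map_add, map_mul, Polynomial.aeval_X, Polynomial.aeval_C, map_pow,
      adjoint_eq_neg_of_inner_self_eq_zero hZ, hneg, Nat.add_sub_cancel, smul_mul_assoc,
      ← pow_add, smul_smul]
    rw [mul_comm μ, mul_comm ν, show m + (m + 1) = 2 * m + 1 by ring,
      show m + 1 + (m + 1) = 2 * m + 2 by ring]
    simp [Algebra.smul_def]
  rw [hop, ← aeval_stabilityPoly, ← Polynomial.aeval_comp, ← hP, gt_iff_lt,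
    ← sq_lt_sq₀ (norm_nonneg _) (norm_nonneg _), norm_aeval_apply_sq hZ, hPP]
  set v := (Z ^ (m + 1)) u with hv
  have hv0 : 0 < ‖v‖ ^ 2 := by positivity
  have hsq : ((-1 : ℝ) ^ (m + 1)) * (-1) ^ (m + 1) = 1 := by rw [← mul_pow]; simp
  have hexp : ⟪(Polynomial.aeval Z (1 + Polynomial.X ^ (2 * (m + 1)) *
      (Polynomial.C ((-1) ^ (m + 1) * δ) + Polynomial.X * (F₁ + F₂)))) u, u⟫
      = ‖u‖ ^ 2 + δ * ‖v‖ ^ 2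
        + (-1) ^ (m + 1) * ⟪Z ((Polynomial.aeval Z (F₁ + F₂)) v), v⟫ := by
    rw [map_add, add_apply, inner_add_left, inner_aeval_X_pow_mul hZ, ← hv, map_add, add_apply,
      inner_add_left, Polynomial.aeval_C, Algebra.algebraMap_eq_smul_one, map_mul,
      Polynomial.aeval_X, mul_apply_eq_comp]
    simp only [map_one, one_apply_eq_self, smul_apply, inner_smul_left, conj_trivial,
      real_inner_self_eq_norm_sq]
    linear_combination δ * ‖v‖ ^ 2 * hsq
  have hZ1 : ‖Z‖ ≤ 1 := hZn.trans (min_le_left _ _)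
  have hbound : |(-1) ^ (m + 1) * ⟪Z ((Polynomial.aeval Z (F₁ + F₂)) v), v⟫|
      ≤ ‖Z‖ * M * ‖v‖ ^ 2 := by
    rw [abs_mul, abs_pow, abs_neg, abs_one, one_pow, one_mul]
    calc |⟪Z ((Polynomial.aeval Z (F₁ + F₂)) v), v⟫|
        ≤ ‖Z ((Polynomial.aeval Z (F₁ + F₂)) v)‖ * ‖v‖ := abs_real_inner_le_norm _ _
      _ ≤ (‖Z‖ * (M * ‖v‖)) * ‖v‖ := by
          gcongr
          exact Z.le_opNorm_of_le (le_of_opNorm_le _ (norm_aeval_le hZ1 _) v)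
      _ = ‖Z‖ * M * ‖v‖ ^ 2 := by ring
  have hsmall : ‖Z‖ * M < δ := by
    have h1 : ‖Z‖ * (M + 1) ≤ δ :=
      (le_div_iff₀ (by positivity)).1 (hZn.trans (min_le_right _ _))
    rcases (norm_nonneg Z).eq_or_lt with h0 | h0
    · rwa [← h0, zero_mul]
    · linarith
  rw [hexp]
  linarith [neg_le_of_abs_le hbound, mul_lt_mul_of_pos_right hsmall hv0]
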